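/- arXiv:1002.4704 — 3 statements merged into one kernel-verified Lean document; each statement's English description precedes it below -/
import Mathlib

section
/- Let D be an acyclic digraph on {1,…,n}, let I ⊆ {1,…,n} be a set of vertices whose corresponding columns of A_D are pairwise equal, and let C be an invertible |I|×|I| matrix over 𝔽₂. Then Φ^I_C(A_D) is the adjacency matrix of an acyclic digraph that is Bott equivalent to D; in fact it is obtained from D by a finite sequence of slides and digraph isomorphisms. -/
/-!
Digraphs on a finite vertex set `V` are modelled as irreflexive relations,
encoded as functions `V → V → Bool`.
-/

variable {V : Type*} [Fintype V] [DecidableEq V]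

/-- The in-neighborhood `N⁻_D(v)` of a vertex `v`. -/
def inN (D : V → V → Bool) (v : V) : Finset V :=
  Finset.univ.filter fun u => D u v = true

/-- The out-neighborhood `N⁺_D(v)` of a vertex `v`. -/
def outN (D : V → V → Bool) (v : V) : Finset V :=
  Finset.univ.filter fun w => D v w = true

/-- The out-degree `deg⁺_D(v)` of a vertex `v`. -/
def outDeg (D : V → V → Bool) (v : V) : ℕ := (outN D v).card

/-- Local complementation `D*v`: for each pair `(u,w) ∈ N⁻_D(v) × N⁺_D(v)` with
`u ≠ w`, the arc `(u,w)` is toggled. -/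
def localComp (D : V → V → Bool) (v : V) : V → V → Bool :=
  fun u w => if u ≠ w ∧ D u v = true ∧ D v w = true then !(D u w) else D u w

/-- The slide `D Δ vw`: the out-neighborhood of `w` is replaced by the symmetric
difference `N⁺_D(w) Δ N⁺_D(v)`; all other arcs are unchanged. -/
def slide (D : V → V → Bool) (v w : V) : V → V → Bool :=
  fun a b => if a = w then xor (D w b) (D v b) else D a b

/-- A digraph is acyclic if it has no directed cycle, i.e. its transitive
closure is irreflexive. -/
def IsAcyclic (D : V → V → Bool) : Prop :=
  ∀ v, ¬ Relation.TransGen (fun a b => D a b = true) v v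

/-- There is a directed walk (in an acyclic digraph: a directed path) with
exactly `k` arcs ending at `v`. -/
def pathEndB (D : V → V → Bool) : ℕ → V → Bool
  | 0, _ => true
  | k+1, v => decide (∃ u, D u v = true ∧ pathEndB D k u = true)

/-- The `k`-th level `L_k(D)`: the set of vertices `v` such that a longest
directed path ending at `v` has exactly `k` arcs. -/
def level (D : V → V → Bool) (k : ℕ) : Finset V :=
  Finset.univ.filter fun v => pathEndB D k v = true ∧ pathEndB D (k+1) v = false

/-- One step of Bott equivalence on digraphs: a local complementation,
a slide, or a digraph isomorphism. -/
def BottStep (D H : V → V → Bool) : Prop :=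
  (∃ v, H = localComp D v) ∨
  (∃ v w, v ≠ w ∧ inN D v = inN D w ∧ H = slide D v w) ∨
  (∃ e : Equiv.Perm V, ∀ a b, H a b = D (e a) (e b))

/-- Two digraphs are Bott equivalent if one is obtained from the other by a
finite sequence of local complementations, slides and isomorphisms. -/
def BottEquiv (D H : V → V → Bool) : Prop :=
  Relation.ReflTransGen BottStep D H

/-- The adjacency matrix of a digraph, over `𝔽₂ = ZMod 2`. -/
def adjMat (D : V → V → Bool) : Matrix V V (ZMod 2) :=
  fun i j => if D i j = true then 1 else 0

/-- Masuda's operation `Φ^I_C`: the submatrix of `A` formed by the rows indexed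
by `I` is replaced by `C` times that submatrix; other rows are unchanged. -/
def PhiIC (I : Finset V) (C : Matrix {x // x ∈ I} {x // x ∈ I} (ZMod 2))
    (A : Matrix V V (ZMod 2)) : Matrix V V (ZMod 2) :=
  fun i j => if h : i ∈ I then ∑ k : {x // x ∈ I}, C ⟨i, h⟩ k * A (k : V) j
    else A i j

/-- One step consisting of a slide or a digraph isomorphism. -/
def SlideIsoStep (D H : V → V → Bool) : Prop :=
  (∃ v w, v ≠ w ∧ inN D v = inN D w ∧ H = slide D v w) ∨
  (∃ e : Equiv.Perm V, ∀ a b, H a b = D (e a) (e b))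

set_option linter.unusedSectionVars false

theorem inN_eq_inN_iff (D : V → V → Bool) (v w : V) :
    inN D v = inN D w ↔ ∀ u, D u v = D u w := by
  simp only [inN, Finset.ext_iff, Finset.mem_filter, Finset.mem_univ, true_and]
  exact forall_congr' fun u => Bool.eq_iff_iff.symm

theorem adjMat_eq_iff (D H : V → V → Bool) (a b c d : V) :
    adjMat D a b = adjMat H c d ↔ D a b = H c d := by
  unfold adjMat
  cases D a b <;> cases H c d <;> simp

theorem IsAcyclic.apply_self {D : V → V → Bool} (hD : IsAcyclic D) (v : V) : D v v = false := by
  by_contra h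
  exact hD v (.single (by simpa using h))

theorem transGen_of_transGen_slide {D : V → V → Bool} (hD : IsAcyclic D) {v w : V}
    (hin : ∀ u, D u v = D u w) {x y : V}
    (h : Relation.TransGen (fun a b => slide D v w a b = true) x y) :
    Relation.TransGen (fun a b => D a b = true) x y ∨
      x = w ∧ Relation.TransGen (fun a b => D a b = true) v y := by
  have arc : ∀ {a b}, slide D v w a b = true → D a b = true ∨ a = w ∧ D v b = true := by
    intro a b hab
    unfold slide at hab
    split_ifs at hab with haw
    · subst haw
      cases h1 : D a b <;> simp_all
    · exact .inl hab
  induction h using Relation.TransGen.head_induction_on with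
  | single hab => exact (arc hab).imp .single fun h => ⟨h.1, .single h.2⟩
  | head hab _ ih =>
    rcases ih with ih | ⟨rfl, ih⟩
    · exact (arc hab).imp (.head · ih) fun h => ⟨h.1, .head h.2 ih⟩
    · rcases arc hab with h | ⟨-, h⟩
      · exact .inl (.head (by simpa [hin] using h) ih)
      · rw [← hin, hD.apply_self] at h
        exact absurd h (by simp)

theorem IsAcyclic.slide {D : V → V → Bool} (hD : IsAcyclic D) {v w : V}
    (hin : ∀ u, D u v = D u w) : IsAcyclic (slide D v w) := by
  intro x hx
  rcases transGen_of_transGen_slide hD hin hx with h | ⟨rfl, h⟩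
  · exact hD x h
  · obtain ⟨u, hvu, hux⟩ := Relation.TransGen.tail'_iff.mp h
    exact hD v (Relation.TransGen.tail' hvu (by simpa [hin] using hux))

theorem PhiIC_apply_of_mem {I : Finset V} (C : Matrix {x // x ∈ I} {x // x ∈ I} (ZMod 2))
    (A : Matrix V V (ZMod 2)) {i : V} (hi : i ∈ I) (j : V) :
    PhiIC I C A i j = (C * A.submatrix (fun k : {x // x ∈ I} => (k : V)) id) ⟨i, hi⟩ j := by
  simp only [PhiIC, hi, dite_true, Matrix.mul_apply, Matrix.submatrix_apply, id]

theorem PhiIC_apply_of_notMem {I : Finset V} (C : Matrix {x // x ∈ I} {x // x ∈ I} (ZMod 2))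
    (A : Matrix V V (ZMod 2)) {i : V} (hi : i ∉ I) (j : V) :
    PhiIC I C A i j = A i j := by
  simp [PhiIC, hi]

theorem PhiIC_one (I : Finset V) (A : Matrix V V (ZMod 2)) : PhiIC I 1 A = A := by
  ext i j
  by_cases hi : i ∈ I
  · rw [PhiIC_apply_of_mem _ _ hi, Matrix.one_mul, Matrix.submatrix_apply, id]
  · exact PhiIC_apply_of_notMem _ _ hi j

theorem PhiIC_mul (I : Finset V) (B C : Matrix {x // x ∈ I} {x // x ∈ I} (ZMod 2))
    (A : Matrix V V (ZMod 2)) : PhiIC I (B * C) A = PhiIC I B (PhiIC I C A) := by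
  have hsub : (PhiIC I C A).submatrix (fun k : {x // x ∈ I} => (k : V)) id =
      C * A.submatrix (fun k : {x // x ∈ I} => (k : V)) id := by
    ext k j
    exact PhiIC_apply_of_mem C A k.2 j
  ext i j
  by_cases hi : i ∈ I
  · rw [PhiIC_apply_of_mem _ _ hi, PhiIC_apply_of_mem _ _ hi, hsub, Matrix.mul_assoc]
  · simp only [PhiIC_apply_of_notMem _ _ hi]

theorem adjMat_slide_eq_PhiIC_transvection (D : V → V → Bool) (I : Finset V)
    (v w : {x // x ∈ I}) :
    adjMat (slide D v w) = PhiIC I (Matrix.transvection w v 1) (adjMat D) := by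
  ext i j
  by_cases hi : i ∈ I
  · rw [PhiIC_apply_of_mem _ _ hi]
    by_cases hw : i = w
    · subst hw
      rw [Subtype.coe_eta, Matrix.transvection_mul_apply_same]
      simp only [adjMat, slide, if_true]
      change _ = (if D w j = true then 1 else 0) + 1 * (if D v j = true then 1 else 0)
      cases D w j <;> cases D v j <;> decide
    · rw [Matrix.transvection_mul_apply_of_ne _ _ _ _ fun h => hw (congrArg Subtype.val h)]
      simp [adjMat, slide, hw]
  · have : i ≠ w := fun h => hi (h ▸ w.2)
    simp [PhiIC_apply_of_notMem _ _ hi, adjMat, slide, this]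

theorem diagonal_eq_one_of_det_ne_zero {ι : Type*} [Fintype ι] [DecidableEq ι] {d : ι → ZMod 2}
    (hd : (Matrix.diagonal d).det ≠ 0) : Matrix.diagonal d = 1 := by
  rw [Matrix.det_diagonal, Finset.prod_ne_zero_iff] at hd
  rw [← Matrix.diagonal_one]
  congr 1
  funext i
  exact Fin.eq_one_of_ne_zero _ (hd i (Finset.mem_univ i))

theorem exists_slideIso_adjMat_eq_PhiIC (I : Finset V)
    (C : Matrix {x // x ∈ I} {x // x ∈ I} (ZMod 2)) (hC : C.det ≠ 0) :
    ∀ D : V → V → Bool, IsAcyclic D → (∀ i ∈ I, ∀ j ∈ I, ∀ r, D r i = D r j) →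
      ∃ H : V → V → Bool, IsAcyclic H ∧ (∀ i ∈ I, ∀ j ∈ I, ∀ r, H r i = H r j) ∧
        Relation.ReflTransGen SlideIsoStep D H ∧ adjMat H = PhiIC I C (adjMat D) := by
  refine Matrix.diagonal_transvection_induction_of_det_ne_zero
    (fun C => ∀ D : V → V → Bool, IsAcyclic D → (∀ i ∈ I, ∀ j ∈ I, ∀ r, D r i = D r j) →
      ∃ H : V → V → Bool, IsAcyclic H ∧ (∀ i ∈ I, ∀ j ∈ I, ∀ r, H r i = H r j) ∧
        Relation.ReflTransGen SlideIsoStep D H ∧ adjMat H = PhiIC I C (adjMat D))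
    C hC ?_ ?_ ?_
  · intro d hd D hD hcols
    exact ⟨D, hD, hcols, .refl, by rw [diagonal_eq_one_of_det_ne_zero hd, PhiIC_one]⟩
  · rintro ⟨w, v, hwv, c⟩ D hD hcols
    rw [Matrix.TransvectionStruct.toMatrix_mk]
    by_cases hc : c = 0
    · exact ⟨D, hD, hcols, .refl, by rw [hc, Matrix.transvection_zero, PhiIC_one]⟩
    · obtain rfl : c = 1 := Fin.eq_one_of_ne_zero _ hc
      have hin := hcols v v.2 w w.2
      have hzero : ∀ a ∈ I, ∀ b ∈ I, D a b = false := fun a ha b hb =>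
        (hcols b hb a ha a).trans (hD.apply_self a)
      refine ⟨slide D v w, hD.slide hin, fun i hi j hj r => ?_,
        .single (.inl ⟨v, w, fun h => hwv (Subtype.ext h.symm),
          (inN_eq_inN_iff D v w).mpr hin, rfl⟩), adjMat_slide_eq_PhiIC_transvection D I v w⟩
      simp [slide, hzero w w.2, hzero v v.2, hi, hj, hcols i hi j hj r]
  · intro A B _ _ ihA ihB D hD hcols
    obtain ⟨H, hH, hHcols, hDH, hHmat⟩ := ihB D hD hcols
    obtain ⟨K, hK, hKcols, hHK, hKmat⟩ := ihA H hH hHcols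
    exact ⟨K, hK, hKcols, hDH.trans hHK, by rw [hKmat, hHmat, PhiIC_mul]⟩

/-- Let `D` be an acyclic digraph on `{1,…,n}`, let `I` be a set of
vertices whose corresponding columns of `A_D` are pairwise equal, and let `C` be
an invertible `|I| × |I|` matrix over `𝔽₂`. Then `Φ^I_C(A_D)` is the adjacency
matrix of an acyclic digraph that is Bott equivalent to `D`; in fact one
obtained from `D` by a finite sequence of slides and digraph isomorphisms. -/
theorem phiIC_adjMat (n : ℕ) (D : Fin n → Fin n → Bool) (hD : IsAcyclic D)
    (I : Finset (Fin n))
    (hcols : ∀ i ∈ I, ∀ j ∈ I, ∀ r, adjMat D r i = adjMat D r j)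
    (C : Matrix {x // x ∈ I} {x // x ∈ I} (ZMod 2)) (hC : IsUnit C) :
    ∃ H : Fin n → Fin n → Bool, IsAcyclic H ∧ BottEquiv D H ∧
      Relation.ReflTransGen SlideIsoStep D H ∧
      adjMat H = PhiIC I C (adjMat D) := by
  obtain ⟨H, hH, -, hDH, hmat⟩ := exists_slideIso_adjMat_eq_PhiIC I C
    ((Matrix.isUnit_iff_isUnit_det C).mp hC).ne_zero D hD
    fun i hi j hj r => (adjMat_eq_iff D D r i r j).mp (hcols i hi j hj r)
  exact ⟨H, hH, Relation.ReflTransGen.mono (fun _ _ h => Or.inr h) _ _ hDH, hDH, hmat⟩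
end

section
/- For every acyclic digraph D, every pair of distinct vertices u, w with N⁻_D(u) = N⁻_D(w), and every k, the k-th level of the slide equals the k-th level of D: L_k(D Δ uw) = L_k(D). Consequently, Bott equivalent acyclic digraphs on n vertices have the identical level sequence (|L_0|, |L_1|, …, |L_{n−1}|). -/
/-!
Digraphs on a finite vertex set `V` are modelled as irreflexive relations,
encoded as functions `V → V → Bool`.
-/

variable {V : Type*} [Fintype V] [DecidableEq V]

set_option linter.unusedSectionVars false

theorem pathEndB_succ_iff (D : V → V → Bool) (k : ℕ) (v : V) :
    pathEndB D (k + 1) v = true ↔ ∃ u, D u v = true ∧ pathEndB D k u = true := by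
  simp [pathEndB]

theorem pathEndB_of_succ (D : V → V → Bool) (k : ℕ) :
    ∀ v, pathEndB D (k + 1) v = true → pathEndB D k v = true := by
  induction k with
  | zero => intro v _; rfl
  | succ k ih =>
    intro v h
    obtain ⟨u, huv, hu⟩ := (pathEndB_succ_iff D (k + 1) v).1 h
    exact (pathEndB_succ_iff D k v).2 ⟨u, huv, ih u hu⟩

theorem inN_eq_iff (D : V → V → Bool) (u w : V) :
    inN D u = inN D w ↔ ∀ a, D a u = D a w := by
  simp only [inN, Finset.ext_iff, Finset.mem_filter_univ]
  exact forall_congr' fun _ => Bool.eq_iff_iff.symm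

theorem pathEndB_congr_inN {D : V → V → Bool} {u w : V} (h : inN D u = inN D w) (k : ℕ) :
    pathEndB D k u = pathEndB D k w := by
  rw [inN_eq_iff] at h
  cases k with
  | zero => rfl
  | succ k => simp [pathEndB, h]

theorem pathEndB_slide {D : V → V → Bool} {u w : V} (huw : u ≠ w) (h : inN D u = inN D w)
    (k : ℕ) : pathEndB (slide D u w) k = pathEndB D k := by
  induction k with
  | zero => rfl
  | succ k ih =>
    funext x
    have hk := pathEndB_congr_inN h k
    rw [Bool.eq_iff_iff, pathEndB_succ_iff, pathEndB_succ_iff, ih]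
    cases hux : D u x with
    | false =>
      have hx : ∀ a, slide D u w a x = D a x := by
        intro a
        by_cases ha : a = w <;> simp [slide, ha, hux]
      simp [hx]
    | true =>
      have hu : slide D u w u x = true := by simp [slide, huw, hux]
      constructor
      · rintro ⟨a, ha, hka⟩
        by_cases haw : a = w
        · exact ⟨u, hux, by rw [hk, ← haw, hka]⟩
        · exact ⟨a, by simpa [slide, haw] using ha, hka⟩
      · rintro ⟨a, ha, hka⟩
        by_cases haw : a = w
        · exact ⟨u, hu, by rw [hk, ← haw, hka]⟩
        · exact ⟨a, by simpa [slide, haw] using ha, hka⟩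

theorem pathEndB_localComp {D : V → V → Bool} {v : V} (hv : D v v = false) (k : ℕ) :
    pathEndB (localComp D v) k = pathEndB D k := by
  induction k with
  | zero => rfl
  | succ k ih =>
    funext x
    rw [Bool.eq_iff_iff, pathEndB_succ_iff, pathEndB_succ_iff, ih]
    cases hvx : D v x with
    | false => simp [localComp, hvx]
    | true =>
      have hv' : localComp D v v x = true := by simp [localComp, hv, hvx]
      have key : ∀ a, D a v = true → pathEndB D k a = true → pathEndB D k v = true :=
        fun a hav ha => pathEndB_of_succ D k v ((pathEndB_succ_iff D k v).2 ⟨a, hav, ha⟩)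
      constructor
      · rintro ⟨a, ha, hka⟩
        by_cases hav : D a v = true
        · exact ⟨v, hvx, key a hav hka⟩
        · exact ⟨a, by simpa [localComp, hav] using ha, hka⟩
      · rintro ⟨a, ha, hka⟩
        by_cases hav : D a v = true
        · exact ⟨v, hv', key a hav hka⟩
        · exact ⟨a, by simpa [localComp, hav] using ha, hka⟩

theorem pathEndB_comp_perm {D H : V → V → Bool} (e : Equiv.Perm V)
    (h : ∀ a b, H a b = D (e a) (e b)) (k : ℕ) :
    ∀ v, pathEndB H k v = pathEndB D k (e v) := by
  induction k with
  | zero => intro v; rfl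
  | succ k ih =>
    intro v
    rw [Bool.eq_iff_iff, pathEndB_succ_iff, pathEndB_succ_iff]
    simp only [h, ih]
    exact e.exists_congr_right (q := fun u => D u (e v) = true ∧ pathEndB D k u = true)

theorem level_slide {D : V → V → Bool} {u w : V} (huw : u ≠ w) (h : inN D u = inN D w)
    (k : ℕ) : level (slide D u w) k = level D k := by
  simp [level, pathEndB_slide huw h]

theorem BottStep.irrefl {D H : V → V → Bool} (hD : ∀ v, D v v = false) (h : BottStep D H) :
    ∀ v, H v v = false := by
  rcases h with ⟨v, rfl⟩ | ⟨v, w, _, h, rfl⟩ | ⟨e, he⟩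
  · intro x
    simp [localComp, hD]
  · intro x
    rw [inN_eq_iff] at h
    by_cases hx : x = w
    · simp [slide, hx, hD, ← h v]
    · simp [slide, hx, hD]
  · intro x
    rw [he, hD]

theorem BottStep.card_level {D H : V → V → Bool} (hD : ∀ v, D v v = false)
    (h : BottStep D H) (k : ℕ) : (level D k).card = (level H k).card := by
  rcases h with ⟨v, rfl⟩ | ⟨v, w, hvw, h, rfl⟩ | ⟨e, he⟩
  · simp [level, pathEndB_localComp (hD v)]
  · rw [level_slide hvw h]
  · exact (Finset.card_equiv e fun v => by
      simp [level, pathEndB_comp_perm e he]).symm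

theorem BottEquiv.irrefl_and_card_level {D H : V → V → Bool} (hD : ∀ v, D v v = false)
    (h : BottEquiv D H) :
    (∀ v, H v v = false) ∧ ∀ k, (level D k).card = (level H k).card := by
  induction h with
  | refl => exact ⟨hD, fun _ => rfl⟩
  | tail _ hs ih => exact ⟨hs.irrefl ih.1, fun k => (ih.2 k).trans (hs.card_level ih.1 k)⟩

/-- For every acyclic digraph `D` and distinct vertices `u, w`
with `N⁻_D(u) = N⁻_D(w)`, the levels of the slide equal the levels of `D`;
consequently, Bott equivalent acyclic digraphs on `n` vertices have the
identical level sequence `(|L_0|, |L_1|, …, |L_{n-1}|)`. -/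
theorem level_slide_and_levelSequence :
    (∀ (D : V → V → Bool), IsAcyclic D → ∀ u w : V, u ≠ w → inN D u = inN D w →
      ∀ k, level (slide D u w) k = level D k) ∧
    (∀ (D H : V → V → Bool), IsAcyclic D → IsAcyclic H → BottEquiv D H →
      ∀ k, (level D k).card = (level H k).card) := by
  refine ⟨fun D _ u w huw h k => level_slide huw h k, fun D H hD _ h k => ?_⟩
  refine (h.irrefl_and_card_level fun v => ?_).2 k
  simpa using fun hv => hD v (Relation.TransGen.single hv)
end

section
/- Let D be an acyclic digraph, v a vertex, and x, y distinct vertices with N⁻_D(x) = N⁻_D(y). Then for every vertex w: deg⁺_{D*v}(w) ≡ deg⁺_D(w) + deg⁺_D(v) (mod 2) if w is an in-neighbor of v, and deg⁺_{D*v}(w) ≡ deg⁺_D(w) (mod 2) otherwise; moreover deg⁺_{D Δ xy}(w) ≡ deg⁺_D(w) + deg⁺_D(x) (mod 2) if w = y, and deg⁺_{D Δ xy}(w) ≡ deg⁺_D(w) (mod 2) otherwise. -/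
/-!
Digraphs on a finite vertex set `V` are modelled as irreflexive relations,
encoded as functions `V → V → Bool`.
-/

variable {V : Type*} [Fintype V] [DecidableEq V]

theorem outDeg_modEq_add_of_xor {W : Type*} [Fintype W] {D H : W → W → Bool} {w u : W}
    (h : ∀ b, H w b = xor (D w b) (D u b)) :
    outDeg H w ≡ outDeg D w + outDeg D u [MOD 2] := by
  rw [← ZMod.natCast_eq_natCast_iff]
  simp only [outDeg, outN, Nat.cast_add, Finset.natCast_card_filter]
  rw [← Finset.sum_add_distrib]
  refine Finset.sum_congr rfl fun b _ => ?_
  rw [h]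
  cases D w b <;> cases D u b <;> decide

theorem outDeg_congr {W : Type*} [Fintype W] {D H : W → W → Bool} {w : W} (h : ∀ b, H w b = D w b) :
    outDeg H w = outDeg D w := by
  simp only [outDeg, outN, h]

theorem IsAcyclic.not_arc_symm {W : Type*} {D : W → W → Bool} (hD : IsAcyclic D) {a b : W}
    (hab : D a b = true) : D b a = false := by
  by_contra hba
  exact hD a (.tail (.single hab) (by simpa using hba))

theorem IsAcyclic.localComp_eq_xor {W : Type*} [DecidableEq W] {D : W → W → Bool}
    (hD : IsAcyclic D) {v w : W}
    (hwv : D w v = true) (b : W) : localComp D v w b = xor (D w b) (D v b) := by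
  have hvw := hD.not_arc_symm hwv
  by_cases hb : w = b
  · subst hb
    simp [localComp, hvw]
  · cases hvb : D v b <;> simp [localComp, hb, hwv, hvb]

/-- Let `D` be an acyclic digraph, `v` a vertex, and `x, y`
distinct vertices with `N⁻_D(x) = N⁻_D(y)`. Then for every vertex `w`:
`deg⁺_{D*v}(w) ≡ deg⁺_D(w) + deg⁺_D(v) (mod 2)` if `w` is an in-neighbor of `v`
and `deg⁺_{D*v}(w) ≡ deg⁺_D(w) (mod 2)` otherwise; moreover
`deg⁺_{D Δ xy}(w) ≡ deg⁺_D(w) + deg⁺_D(x) (mod 2)` if `w = y` and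
`deg⁺_{D Δ xy}(w) ≡ deg⁺_D(w) (mod 2)` otherwise. -/
theorem outDeg_localComp_slide (D : V → V → Bool) (hD : IsAcyclic D)
    (v x y : V) (hxy : x ≠ y) (hin : inN D x = inN D y) (w : V) :
    (D w v = true →
      outDeg (localComp D v) w ≡ outDeg D w + outDeg D v [MOD 2]) ∧
    (D w v = false → outDeg (localComp D v) w ≡ outDeg D w [MOD 2]) ∧
    (w = y → outDeg (slide D x y) w ≡ outDeg D w + outDeg D x [MOD 2]) ∧
    (w ≠ y → outDeg (slide D x y) w ≡ outDeg D w [MOD 2]) := by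
  refine ⟨fun h => outDeg_modEq_add_of_xor (hD.localComp_eq_xor h), fun h => ?_, ?_, fun h => ?_⟩
  · exact congrArg (· % 2) (outDeg_congr fun b => by simp [localComp, h])
  · rintro rfl
    exact outDeg_modEq_add_of_xor fun b => by simp [slide]
  · exact congrArg (· % 2) (outDeg_congr fun b => by simp [slide, h])
end
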